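/- arXiv:2006.06982 — 2 statements merged into one kernel-verified Lean document; each statement's English description precedes it below -/
import Mathlib

section
/- (Central limit theorem for bounded martingale differences with unit conditional variance; core of the proof of Theorem 1.) Let (z_t)_{t≥1} be a martingale difference sequence with respect to a filtration (𝔉_t) such that |z_t| ≤ C almost surely for all t and E[z_t² ∣ 𝔉_{t-1}] = 1 almost surely for all t. Then T^{-1/2} ∑_{t=1}^T z_t converges in distribution to the standard normal N(0,1) as T → ∞. -/
open MeasureTheory ProbabilityTheory Filter Finset Topology

lemma norm_sub_pow_mul_le_of_norm_succ_sub_mul_le {u : ℕ → ℂ} {q : ℂ} {δ : ℝ} (hq : ‖q‖ ≤ 1)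
    (hu : ∀ k, ‖u (k + 1) - q * u k‖ ≤ δ) (n : ℕ) : ‖u n - q ^ n * u 0‖ ≤ n * δ := by
  induction n with
  | zero => simp
  | succ n ih =>
    calc ‖u (n + 1) - q ^ (n + 1) * u 0‖
        = ‖(u (n + 1) - q * u n) + q * (u n - q ^ n * u 0)‖ := by ring_nf
      _ ≤ ‖u (n + 1) - q * u n‖ + ‖q‖ * ‖u n - q ^ n * u 0‖ := by
        rw [← norm_mul]; exact norm_add_le _ _
      _ ≤ δ + 1 * (n * δ) := by
        gcongr
        exact hu n
      _ = ((n + 1 : ℕ) : ℝ) * δ := by push_cast; ring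

lemma norm_cexp_ofReal_mul_I_sub_taylor_two_le {x : ℝ} (hx : |x| ≤ 1) :
    ‖Complex.exp (x * Complex.I) - 1 - x * Complex.I + (x : ℂ) ^ 2 / 2‖ ≤ |x| ^ 3 := by
  have hnorm : ‖(x : ℂ) * Complex.I‖ = |x| := by simp
  have h := Complex.exp_bound (x := x * Complex.I) (by rwa [hnorm]) (n := 3) (by norm_num)
  rw [hnorm] at h
  have hsum : ∑ m ∈ Finset.range 3, ((x : ℂ) * Complex.I) ^ m / (m.factorial : ℂ)
      = 1 + x * Complex.I - (x : ℂ) ^ 2 / 2 := by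
    simp [Finset.sum_range_succ, mul_pow, Nat.factorial]
    ring
  rw [hsum] at h
  calc _ = ‖Complex.exp (x * Complex.I) - (1 + x * Complex.I - (x : ℂ) ^ 2 / 2)‖ := by ring_nf
    _ ≤ _ := h
    _ ≤ |x| ^ 3 * 1 := by
      gcongr
      norm_num [Nat.factorial]
    _ = |x| ^ 3 := mul_one _

section

variable {Ω : Type*} {m m0 : MeasurableSpace Ω} {P : Measure Ω}

lemma integral_smul_eq_of_condExp_eq_const [IsFiniteMeasure P] (hm : m ≤ m0) {f : Ω → ℝ}
    {W : Ω → ℂ} {c : ℝ} (hW : StronglyMeasurable[m] W) (hf : Integrable f P)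
    (hfW : Integrable (f • W) P) (hc : P[f | m] =ᵐ[P] fun _ => c) :
    ∫ ω, (f • W) ω ∂P = c * ∫ ω, W ω ∂P := by
  have h := condExp_smul_of_aestronglyMeasurable_right (μ := P) hf hfW hW.aestronglyMeasurable
  rw [← integral_condExp hm, ← integral_const_mul]
  refine integral_congr_ae ?_
  filter_upwards [h, hc] with ω h1 h2
  simp [h1, h2]

lemma norm_integral_cexp_add_sub_le [IsProbabilityMeasure P] (hm : m ≤ m0) {S ζ : Ω → ℝ} {C a : ℝ}
    (hS : Measurable[m] S) (hint : Integrable ζ P) (hbdd : ∀ᵐ ω ∂P, |ζ ω| ≤ C)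
    (hmean : P[ζ | m] =ᵐ[P] fun _ => (0 : ℝ))
    (hvar : P[(fun ω => (ζ ω) ^ 2) | m] =ᵐ[P] fun _ => (1 : ℝ)) (ha : |a| * C ≤ 1) :
    ‖∫ ω, Complex.exp ((a * (S ω + ζ ω) : ℝ) * Complex.I) ∂P
      - (1 - a ^ 2 / 2) * ∫ ω, Complex.exp ((a * S ω : ℝ) * Complex.I) ∂P‖ ≤ (|a| * C) ^ 3 := by
  set W : Ω → ℂ := fun ω => Complex.exp ((a * S ω : ℝ) * Complex.I) with hWdef
  have hWm : Measurable[m] W := by fun_prop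
  have hWnorm (ω : Ω) : ‖W ω‖ = 1 := Complex.norm_exp_ofReal_mul_I _
  have hWm0 : AEStronglyMeasurable W P := (hWm.mono hm le_rfl).aestronglyMeasurable
  have hWint : Integrable W P :=
    (integrable_const (1 : ℝ)).mono' hWm0 (ae_of_all _ fun ω => (hWnorm ω).le)
  have hSm : AEMeasurable S P := (hS.mono hm le_rfl).aemeasurable
  have hζm : AEMeasurable ζ P := hint.aemeasurable
  have hsq : Integrable (fun ω => (ζ ω) ^ 2) P := by
    refine (integrable_const (C ^ 2)).mono' (by fun_prop) ?_
    filter_upwards [hbdd] with ω hω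
    rw [Real.norm_eq_abs, abs_pow]
    gcongr
  have hmul {f : Ω → ℝ} (hf : Integrable f P) : Integrable (f • W) P := by
    refine hf.norm.mono' (hf.aestronglyMeasurable.smul hWm0) (ae_of_all _ fun ω => ?_)
    simp [hWnorm]
  have h1 := integral_smul_eq_of_condExp_eq_const hm hWm.stronglyMeasurable hint (hmul hint) hmean
  have h2 := integral_smul_eq_of_condExp_eq_const hm hWm.stronglyMeasurable hsq (hmul hsq) hvar
  have hE : Integrable (fun ω => Complex.exp ((a * (S ω + ζ ω) : ℝ) * Complex.I)) P :=
    (integrable_const (1 : ℝ)).mono' (AEMeasurable.aestronglyMeasurable (by fun_prop))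
      (ae_of_all _ fun ω => (Complex.norm_exp_ofReal_mul_I _).le)
  have key : ∫ ω, Complex.exp ((a * (S ω + ζ ω) : ℝ) * Complex.I) ∂P
      - (1 - a ^ 2 / 2) * ∫ ω, W ω ∂P
      = ∫ ω, (Complex.exp ((a * (S ω + ζ ω) : ℝ) * Complex.I) - W ω
          - a * Complex.I * (ζ • W) ω + a ^ 2 / 2 * ((fun ω => (ζ ω) ^ 2) • W) ω) ∂P := by
    have hEW : Integrable
        (fun ω => Complex.exp ((a * (S ω + ζ ω) : ℝ) * Complex.I) - W ω) P := hE.sub hWint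
    have hEWζ : Integrable (fun ω => Complex.exp ((a * (S ω + ζ ω) : ℝ) * Complex.I) - W ω
        - a * Complex.I * (ζ • W) ω) P := hEW.sub ((hmul hint).const_mul _)
    rw [integral_add hEWζ ((hmul hsq).const_mul _), integral_sub hEW ((hmul hint).const_mul _),
      integral_sub hE hWint, integral_const_mul, integral_const_mul, h1, h2]
    push_cast
    ring
  rw [key]
  refine (norm_integral_le_of_norm_le_const (C := (|a| * C) ^ 3) ?_).trans (by simp)
  filter_upwards [hbdd] with ω hω
  have hx : |a * ζ ω| ≤ |a| * C := by rw [abs_mul]; gcongr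
  have hfac : Complex.exp ((a * (S ω + ζ ω) : ℝ) * Complex.I) - W ω
      - a * Complex.I * (ζ • W) ω + a ^ 2 / 2 * ((fun ω => (ζ ω) ^ 2) • W) ω
      = W ω * (Complex.exp ((a * ζ ω : ℝ) * Complex.I) - 1 - (a * ζ ω : ℝ) * Complex.I
        + ((a * ζ ω : ℝ) : ℂ) ^ 2 / 2) := by
    have : Complex.exp ((a * (S ω + ζ ω) : ℝ) * Complex.I)
        = W ω * Complex.exp ((a * ζ ω : ℝ) * Complex.I) := by
      rw [hWdef, ← Complex.exp_add]
      push_cast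
      ring_nf
    rw [this]
    simp only [Pi.smul_apply', Complex.real_smul]
    push_cast
    ring
  rw [hfac, norm_mul, hWnorm, one_mul]
  exact (norm_cexp_ofReal_mul_I_sub_taylor_two_le (hx.trans ha)).trans (by gcongr)

end

/-- **CLT for bounded martingale differences with unit conditional variance.** -/
theorem mds_clt_unit_conditional_variance
    {Ω : Type*} [m0 : MeasurableSpace Ω] {P : Measure Ω} [IsProbabilityMeasure P]
    (F : MeasureTheory.Filtration ℕ m0)
    (z : ℕ → Ω → ℝ) (C : ℝ)
    (hint : ∀ t, 1 ≤ t → Integrable (z t) P)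
    (hmeas : ∀ t, 1 ≤ t → Measurable[F t] (z t))
    (hbdd : ∀ t, 1 ≤ t → ∀ᵐ ω ∂P, |z t ω| ≤ C)
    (hmds : ∀ t, 1 ≤ t → P[z t | F (t - 1)] =ᵐ[P] fun _ => (0 : ℝ))
    (hvar : ∀ t, 1 ≤ t → P[(fun ω => (z t ω) ^ 2) | F (t - 1)] =ᵐ[P] fun _ => (1 : ℝ)) :
    ∀ g : BoundedContinuousFunction ℝ ℝ,
      Tendsto (fun T : ℕ => ∫ ω, g ((Real.sqrt (T : ℝ))⁻¹ * ∑ t ∈ Finset.Icc 1 T, z t ω) ∂P)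
        atTop (𝓝 (∫ x, g x ∂(gaussianReal 0 1))) := by
  have hSF (k : ℕ) : Measurable[F k] fun ω => ∑ t ∈ Finset.Icc 1 k, z t ω :=
    Finset.measurable_sum _ fun t ht =>
      (hmeas t (Finset.mem_Icc.1 ht).1).mono (F.mono (Finset.mem_Icc.1 ht).2) le_rfl
  have hS (k : ℕ) : Measurable fun ω => ∑ t ∈ Finset.Icc 1 k, z t ω :=
    (hSF k).mono (F.le k) le_rfl
  have hX (T : ℕ) : AEMeasurable
      (fun ω => (Real.sqrt (T : ℝ))⁻¹ * ∑ t ∈ Finset.Icc 1 T, z t ω) P :=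
    ((hS T).const_mul _).aemeasurable
  have hbound (s : ℝ) (T : ℕ) (h1 : |s * (Real.sqrt T)⁻¹| * C ≤ 1)
      (h2 : |s * (Real.sqrt T)⁻¹| ≤ 1) :
      ‖charFun (P.map fun ω => (Real.sqrt (T : ℝ))⁻¹ * ∑ t ∈ Finset.Icc 1 T, z t ω) s
        - (1 - ((s * (Real.sqrt T)⁻¹ : ℝ) : ℂ) ^ 2 / 2) ^ T‖
        ≤ T * (|s * (Real.sqrt T)⁻¹| * C) ^ 3 := by
    set a : ℝ := s * (Real.sqrt T)⁻¹ with ha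
    have hq : ‖(1 - (a : ℂ) ^ 2 / 2)‖ ≤ 1 := by
      have h3 : a ^ 2 ≤ 1 := (sq_le_one_iff_abs_le_one a).2 h2
      have h4 : (1 - (a : ℂ) ^ 2 / 2) = ((1 - a ^ 2 / 2 : ℝ) : ℂ) := by push_cast; ring
      rw [h4, Complex.norm_real, Real.norm_eq_abs, abs_le]
      constructor <;> nlinarith [sq_nonneg a]
    have h := norm_sub_pow_mul_le_of_norm_succ_sub_mul_le
      (u := fun k => ∫ ω, Complex.exp ((a * ∑ t ∈ Finset.Icc 1 k, z t ω : ℝ) * Complex.I) ∂P)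
      hq (fun k => ?_) T (δ := (|a| * C) ^ 3)
    · rw [charFun_apply_real, integral_map (hX T) (by fun_prop)]
      convert h using 3
      · refine integral_congr_ae (ae_of_all _ fun ω => ?_)
        simp only [ha]
        push_cast
        ring_nf
      · simp
    · have hk : 1 ≤ k + 1 := by omega
      simp only [Finset.sum_Icc_succ_top hk]
      exact norm_integral_cexp_add_sub_le (F.le k) (hSF k) (hint _ hk) (hbdd _ hk)
        (hmds _ hk) (hvar _ hk) h1
  have hdist : TendstoInDistribution
      (fun (T : ℕ) ω => (Real.sqrt (T : ℝ))⁻¹ * ∑ t ∈ Finset.Icc 1 T, z t ω) atTop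
      (id : ℝ → ℝ) (fun _ => P) (gaussianReal 0 1) :=
    { forall_aemeasurable := hX
      tendsto := by
        refine ProbabilityMeasure.tendsto_iff_tendsto_charFun.2 fun s => ?_
        have ha : Tendsto (fun T : ℕ => s * (Real.sqrt T)⁻¹) atTop (𝓝 0) := by
          rw [← mul_zero s]
          exact .const_mul s (tendsto_inv_atTop_zero.comp <| Real.tendsto_sqrt_atTop.comp <|
            tendsto_natCast_atTop_atTop)
        have hpow : Tendsto (fun T : ℕ => (1 - ((s * (Real.sqrt T)⁻¹ : ℝ) : ℂ) ^ 2 / 2) ^ T) atTop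
            (𝓝 (Complex.exp (-s ^ 2 / 2))) := by
          refine (Complex.tendsto_one_add_div_pow_exp (-(s : ℂ) ^ 2 / 2)).congr fun T => ?_
          congr 1
          have : ((s * (Real.sqrt T)⁻¹ : ℝ) : ℂ) ^ 2 = (s : ℂ) ^ 2 / T := by
            rw [← Complex.ofReal_pow, mul_pow, inv_pow, Real.sq_sqrt (by positivity)]
            push_cast
            rw [div_eq_mul_inv]
          rw [this]
          ring
        have herr : Tendsto (fun T : ℕ => (T : ℝ) * (|s * (Real.sqrt T)⁻¹| * C) ^ 3) atTop
            (𝓝 0) := by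
          have h0 : Tendsto (fun T : ℕ => s ^ 2 * C ^ 3 * |s * (Real.sqrt T)⁻¹|) atTop (𝓝 0) := by
            simpa using ha.abs.const_mul (s ^ 2 * C ^ 3)
          refine h0.congr' ?_
          filter_upwards [eventually_gt_atTop 0] with T hT
          have hT' : (0 : ℝ) < T := by exact_mod_cast hT
          have : |s * (Real.sqrt T)⁻¹| ^ 2 = s ^ 2 / T := by
            rw [sq_abs, mul_pow, inv_pow, Real.sq_sqrt hT'.le, div_eq_mul_inv]
          rw [mul_pow, pow_succ |_| 2, this]
          field_simp
        have hsmall : ∀ᶠ T : ℕ in atTop,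
            |s * (Real.sqrt T)⁻¹| * C ≤ 1 ∧ |s * (Real.sqrt T)⁻¹| ≤ 1 := by
          have h0 := ha.abs
          have h1 := h0.mul_const C
          simp only [abs_zero, zero_mul] at h0 h1
          exact (h1.eventually_le_const one_pos).and (h0.eventually_le_const one_pos)
        have hdiff := squeeze_zero_norm' (hsmall.mono fun T hT => hbound s T hT.1 hT.2) herr
        simpa [charFun_gaussianReal, neg_div] using hdiff.add hpow }
  intro g
  have h := (ProbabilityMeasure.tendsto_iff_forall_integral_tendsto.1 hdist.tendsto) g
  simp only [ProbabilityMeasure.coe_mk, Measure.map_id] at h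
  refine h.congr fun T => ?_
  exact integral_map (hX T) g.continuous.aestronglyMeasurable
end

section
/- (Central limit theorem for bounded martingale differences with asymptotically standardized conditional variance; core of the proof of Theorem 4.) Let (z_t)_{t≥1} be a martingale difference sequence with respect to a filtration (𝔉_t) such that |z_t| ≤ C almost surely for all t and E[ |E[z_t² ∣ 𝔉_{t-1}] − 1| ] → 0 as t → ∞. Then T^{-1/2} ∑_{t=1}^T z_t converges in distribution to the standard normal N(0,1) as T → ∞. -/
open MeasureTheory ProbabilityTheory Filter Finset Topology

theorem norm_cexp_ofReal_mul_I_sub_quadratic_le (x : ℝ) :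
    ‖Complex.exp (x * Complex.I) - (1 + x * Complex.I - (x : ℂ) ^ 2 / 2)‖
      ≤ |x| ^ 3 * Real.exp |x| := by
  have h := Complex.norm_exp_sub_sum_le_norm_mul_exp (x * Complex.I) 3
  have hsum : ∑ m ∈ Finset.range 3, ((x : ℂ) * Complex.I) ^ m / (m.factorial : ℂ)
      = 1 + x * Complex.I - (x : ℂ) ^ 2 / 2 := by
    simp [Finset.sum_range_succ, mul_pow, Nat.factorial]
    ring
  rw [hsum] at h
  simpa using h

theorem norm_sub_pow_mul_le_sum {d : ℕ → ℂ} {a : ℂ} {e : ℕ → ℝ} (ha : ‖a‖ ≤ 1)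
    (hd : ∀ n, ‖d (n + 1) - a * d n‖ ≤ e n) (n : ℕ) :
    ‖d n - a ^ n * d 0‖ ≤ ∑ i ∈ Finset.range n, e i := by
  induction n with
  | zero => simp
  | succ n ih =>
    rw [Finset.sum_range_succ]
    calc ‖d (n + 1) - a ^ (n + 1) * d 0‖
        = ‖a * (d n - a ^ n * d 0) + (d (n + 1) - a * d n)‖ := by congr 1; ring
      _ ≤ ‖a‖ * ‖d n - a ^ n * d 0‖ + ‖d (n + 1) - a * d n‖ := by
          rw [← norm_mul]; exact norm_add_le _ _
      _ ≤ ∑ i ∈ Finset.range n, e i + e n := by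
          gcongr
          · exact (mul_le_of_le_one_left (norm_nonneg _) ha).trans ih
          · exact hd n

section

variable {Ω : Type*} {m m0 : MeasurableSpace Ω} {P : Measure Ω} [IsProbabilityMeasure P]

theorem integral_mul_ofReal_condExp (hm : m ≤ m0) {W : Ω → ℂ} {X : Ω → ℝ}
    (hW : StronglyMeasurable[m] W) {c : ℝ} (hWc : ∀ ω, ‖W ω‖ ≤ c) (hX : Integrable X P) :
    ∫ ω, W ω * (P[X | m] ω : ℂ) ∂P = ∫ ω, W ω * (X ω : ℂ) ∂P := by
  have hint : Integrable (fun ω => W ω * (X ω : ℂ)) P :=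
    hX.ofReal.bdd_mul (hW.mono hm).aestronglyMeasurable (ae_of_all _ hWc)
  have h := condExp_bilin_of_stronglyMeasurable_left (μ := P)
    (ContinuousLinearMap.lsmul ℝ ℝ (E := ℂ)).flip hW (g := X)
    (by simpa [mul_comm] using hint) hX
  simp only [ContinuousLinearMap.flip_apply, ContinuousLinearMap.lsmul_apply,
    Complex.real_smul, mul_comm (Complex.ofReal _)] at h
  exact (integral_congr_ae h).symm.trans (integral_condExp hm)

theorem norm_charFun_step_le (hm : m ≤ m0) {S Z : Ω → ℝ} {C : ℝ} (h : ℝ)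
    (hS : Measurable[m] S) (hZ : Measurable Z) (hbdd : ∀ᵐ ω ∂P, |Z ω| ≤ C)
    (hmean : P[Z | m] =ᵐ[P] fun _ => (0 : ℝ)) :
    ‖∫ ω, Complex.exp ((h * (S ω + Z ω) : ℝ) * Complex.I) ∂P
        - ((1 - h ^ 2 / 2 : ℝ) : ℂ) * ∫ ω, Complex.exp ((h * S ω : ℝ) * Complex.I) ∂P‖
      ≤ h ^ 2 / 2 * ∫ ω, |P[fun ω' => Z ω' ^ 2 | m] ω - 1| ∂P
        + (|h| * C) ^ 3 * Real.exp (|h| * C) := by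
  set W : Ω → ℂ := fun ω => Complex.exp ((h * S ω : ℝ) * Complex.I) with hWdef
  have hWm : StronglyMeasurable[m] W := by
    refine Measurable.stronglyMeasurable ?_
    fun_prop
  have hWn : ∀ ω, ‖W ω‖ = 1 := fun ω => Complex.norm_exp_ofReal_mul_I _
  have hWae : AEStronglyMeasurable W P := (hWm.mono hm).aestronglyMeasurable
  have hWmul : ∀ {Y : Ω → ℂ}, Integrable Y P → Integrable (fun ω => W ω * Y ω) P := fun hY =>
    hY.bdd_mul hWae (ae_of_all _ fun ω => (hWn ω).le)
  have hWmul' : ∀ {Y : Ω → ℝ}, Integrable Y P → Integrable (fun ω => W ω * (Y ω : ℂ)) P :=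
    fun hY => hWmul hY.ofReal
  have hZint : Integrable Z P :=
    Integrable.of_bound hZ.aestronglyMeasurable C (by simpa using hbdd)
  have hZ2int : Integrable (fun ω => Z ω ^ 2) P := by
    refine Integrable.of_bound (hZ.pow_const 2).aestronglyMeasurable (C ^ 2) ?_
    filter_upwards [hbdd] with ω hω
    rw [Real.norm_eq_abs, abs_pow]
    gcongr
  have hcint : Integrable (P[fun ω' => Z ω' ^ 2 | m]) P := integrable_condExp
  set R : Ω → ℂ := fun ω => Complex.exp ((h * Z ω : ℝ) * Complex.I)
    - (1 + (h * Z ω : ℝ) * Complex.I - ((h * Z ω : ℝ) : ℂ) ^ 2 / 2) with hRdef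
  have hRbound : ∀ᵐ ω ∂P, ‖R ω‖ ≤ (|h| * C) ^ 3 * Real.exp (|h| * C) := by
    filter_upwards [hbdd] with ω hω
    refine (norm_cexp_ofReal_mul_I_sub_quadratic_le (h * Z ω)).trans ?_
    have hC : 0 ≤ C := (abs_nonneg _).trans hω
    rw [abs_mul]
    gcongr
  have hRint : Integrable R P := by
    refine Integrable.of_bound (Measurable.aestronglyMeasurable ?_) _ hRbound
    fun_prop
  have hW0 : Integrable W P := by simpa using hWmul (integrable_const (1 : ℂ))
  have hWZ : ∫ ω, W ω * (Z ω : ℂ) ∂P = 0 := by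
    rw [← integral_mul_ofReal_condExp hm hWm (fun ω => (hWn ω).le) hZint]
    rw [integral_congr_ae (g := fun _ => (0 : ℂ)), integral_zero]
    filter_upwards [hmean] with ω hω
    simp [hω]
  have hWV : ∫ ω, W ω * ((P[fun ω' => Z ω' ^ 2 | m] ω - 1 : ℝ) : ℂ) ∂P
      = ∫ ω, W ω * ((Z ω ^ 2 : ℝ) : ℂ) ∂P - ∫ ω, W ω ∂P := by
    rw [← integral_mul_ofReal_condExp hm hWm (fun ω => (hWn ω).le) hZ2int,
      ← integral_sub (hWmul' hcint) hW0]
    congr 1 with ω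
    push_cast
    ring
  have hkey : ∫ ω, Complex.exp ((h * (S ω + Z ω) : ℝ) * Complex.I) ∂P
        - ((1 - h ^ 2 / 2 : ℝ) : ℂ) * ∫ ω, W ω ∂P
      = -((h ^ 2 / 2 : ℝ) : ℂ) * ∫ ω, W ω * ((P[fun ω' => Z ω' ^ 2 | m] ω - 1 : ℝ) : ℂ) ∂P
        + ∫ ω, W ω * R ω ∂P := by
    have hexp : ∀ ω, Complex.exp ((h * (S ω + Z ω) : ℝ) * Complex.I)
        = W ω + (h * Complex.I) * (W ω * (Z ω : ℂ))
          - ((h ^ 2 / 2 : ℝ) : ℂ) * (W ω * ((Z ω ^ 2 : ℝ) : ℂ)) + W ω * R ω := fun ω => by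
      have : Complex.exp ((h * (S ω + Z ω) : ℝ) * Complex.I)
          = W ω * Complex.exp ((h * Z ω : ℝ) * Complex.I) := by
        rw [hWdef, ← Complex.exp_add]
        congr 1
        push_cast
        ring
      rw [this, hRdef]
      push_cast
      ring
    have i1 := (hWmul' hZint).const_mul (h * Complex.I)
    have i2 := (hWmul' hZ2int).const_mul ((h ^ 2 / 2 : ℝ) : ℂ)
    have i3 : Integrable (fun ω => W ω + (h * Complex.I) * (W ω * (Z ω : ℂ))) P := hW0.add i1
    have i4 : Integrable (fun ω => W ω + (h * Complex.I) * (W ω * (Z ω : ℂ))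
        - ((h ^ 2 / 2 : ℝ) : ℂ) * (W ω * ((Z ω ^ 2 : ℝ) : ℂ))) P := i3.sub i2
    rw [hWV, integral_congr_ae (ae_of_all _ hexp),
      integral_add i4 (hWmul hRint), integral_sub i3 i2, integral_add hW0 i1, integral_const_mul, integral_const_mul, hWZ]
    push_cast
    ring
  rw [hkey]
  refine (norm_add_le _ _).trans (add_le_add ?_ ?_)
  · rw [norm_mul, norm_neg, Complex.norm_real, Real.norm_of_nonneg (by positivity)]
    gcongr
    refine (norm_integral_le_integral_norm _).trans_eq ?_
    congr 1 with ω
    rw [norm_mul, hWn, one_mul, Complex.norm_real, Real.norm_eq_abs]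
  · refine (norm_integral_le_of_norm_le_const (C := (|h| * C) ^ 3 * Real.exp (|h| * C)) ?_).trans_eq
      (by simp)
    filter_upwards [hRbound] with ω hω
    rwa [norm_mul, hWn, one_mul]

end

theorem tendsto_charFun_normalized_sum_mds
    {Ω : Type*} [m0 : MeasurableSpace Ω] {P : Measure Ω} [IsProbabilityMeasure P]
    (F : MeasureTheory.Filtration ℕ m0)
    (z : ℕ → Ω → ℝ) (C : ℝ)
    (hmeas : ∀ t, 1 ≤ t → Measurable[F t] (z t))
    (hbdd : ∀ t, 1 ≤ t → ∀ᵐ ω ∂P, |z t ω| ≤ C)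
    (hmds : ∀ t, 1 ≤ t → P[z t | F (t - 1)] =ᵐ[P] fun _ => (0 : ℝ))
    (hvar : Tendsto
      (fun t : ℕ => ∫ ω, |(P[(fun ω' => (z t ω') ^ 2) | F (t - 1)]) ω - 1| ∂P) atTop (𝓝 0))
    (u : ℝ) :
    Tendsto (fun T : ℕ => ∫ ω, Complex.exp
        (((u * (Real.sqrt (T : ℝ))⁻¹) * ∑ t ∈ Finset.Icc 1 T, z t ω : ℝ) * Complex.I) ∂P)
      atTop (𝓝 (Complex.exp (-(u : ℂ) ^ 2 / 2))) := by
  set v : ℕ → ℝ := fun t => ∫ ω, |P[fun ω' => z t ω' ^ 2 | F (t - 1)] ω - 1| ∂P with hv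
  set h : ℕ → ℝ := fun T => u * (Real.sqrt (T : ℝ))⁻¹ with hh
  set S : ℕ → Ω → ℝ := fun n ω => ∑ t ∈ Finset.Icc 1 n, z t ω with hSdef
  have hS : ∀ n, Measurable[F n] (S n) := fun n => by
    refine Finset.measurable_fun_sum _ fun t ht => ?_
    rw [Finset.mem_Icc] at ht
    exact (hmeas t ht.1).mono (F.mono ht.2) le_rfl
  have hh0 : Tendsto h atTop (𝓝 0) := by
    rw [← mul_zero u]
    exact (tendsto_inv_atTop_zero.comp
      (Real.tendsto_sqrt_atTop.comp tendsto_natCast_atTop_atTop)).const_mul u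
  have hhsq : ∀ T : ℕ, h T ^ 2 = u ^ 2 * (T : ℝ)⁻¹ := fun T => by
    rw [hh, mul_pow, inv_pow, Real.sq_sqrt (Nat.cast_nonneg T)]
  have hstep : ∀ T n, ‖∫ ω, Complex.exp ((h T * S (n + 1) ω : ℝ) * Complex.I) ∂P
        - ((1 - h T ^ 2 / 2 : ℝ) : ℂ) * ∫ ω, Complex.exp ((h T * S n ω : ℝ) * Complex.I) ∂P‖
      ≤ h T ^ 2 / 2 * v (n + 1) + (|h T| * C) ^ 3 * Real.exp (|h T| * C) := fun T n => by
    have hn : 1 ≤ n + 1 := Nat.le_add_left 1 n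
    have := norm_charFun_step_le (F.le n) (h T) (hS n)
      ((hmeas (n + 1) hn).mono (F.le _) le_rfl) (hbdd (n + 1) hn) (hmds (n + 1) hn)
    simpa only [hSdef, hv, Finset.sum_Icc_succ_top hn, Nat.add_sub_cancel] using this
  have hsmall : ∀ᶠ T in atTop, ‖((1 - h T ^ 2 / 2 : ℝ) : ℂ)‖ ≤ 1 := by
    have : Tendsto (fun T => h T ^ 2) atTop (𝓝 0) := by simpa using hh0.pow 2
    filter_upwards [this.eventually_le_const one_pos] with T hT
    rw [Complex.norm_real, Real.norm_eq_abs, abs_le]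
    constructor <;> nlinarith [sq_nonneg (h T)]
  have herr : Tendsto (fun T : ℕ => ∑ n ∈ Finset.range T,
      (h T ^ 2 / 2 * v (n + 1) + (|h T| * C) ^ 3 * Real.exp (|h T| * C))) atTop (𝓝 0) := by
    have h1 : Tendsto (fun T : ℕ => u ^ 2 / 2 * ((T : ℝ)⁻¹ * ∑ n ∈ Finset.range T, v (n + 1)))
        atTop (𝓝 0) := by
      simpa using ((hvar.comp (tendsto_add_atTop_nat 1)).cesaro).const_mul (u ^ 2 / 2)
    have h2 : Tendsto (fun T : ℕ => u ^ 2 * (|h T| * C ^ 3 * Real.exp (|h T| * C)))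
        atTop (𝓝 0) := by
      have habs : Tendsto (fun T => |h T|) atTop (𝓝 0) := by simpa using hh0.abs
      have hexp := (Real.continuous_exp.tendsto _).comp (habs.mul_const C)
      simpa using ((habs.mul_const (C ^ 3)).mul hexp).const_mul (u ^ 2)
    refine (add_zero (0 : ℝ) ▸ h1.add h2).congr' ?_
    filter_upwards [eventually_gt_atTop 0] with T hT
    have hT' : (T : ℝ) ≠ 0 := Nat.cast_ne_zero.2 hT.ne'
    have hcube : (|h T| * C) ^ 3 = u ^ 2 * (T : ℝ)⁻¹ * |h T| * C ^ 3 := by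
      rw [← hhsq, ← sq_abs (h T)]
      ring
    rw [Finset.sum_add_distrib, ← Finset.mul_sum, Finset.sum_const, Finset.card_range,
      nsmul_eq_mul, hcube, hhsq]
    field_simp
  have hpow : Tendsto (fun T : ℕ => ((1 - h T ^ 2 / 2 : ℝ) : ℂ) ^ T) atTop
      (𝓝 (Complex.exp (-(u : ℂ) ^ 2 / 2))) := by
    refine (Complex.tendsto_one_add_div_pow_exp (-(u : ℂ) ^ 2 / 2)).congr fun T => ?_
    rw [hhsq]
    push_cast
    congr 1
    ring
  have hdiff : Tendsto (fun T : ℕ => ∫ ω, Complex.exp ((h T * S T ω : ℝ) * Complex.I) ∂P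
      - ((1 - h T ^ 2 / 2 : ℝ) : ℂ) ^ T) atTop (𝓝 0) := by
    refine squeeze_zero_norm' ?_ herr
    filter_upwards [hsmall] with T hT
    simpa [hSdef] using norm_sub_pow_mul_le_sum
      (d := fun n => ∫ ω, Complex.exp ((h T * S n ω : ℝ) * Complex.I) ∂P) hT (hstep T) T
  simpa only [sub_add_cancel, zero_add] using hdiff.add hpow

/-- **CLT for bounded martingale differences with asymptotically standardized
conditional variance.** -/
theorem mds_clt_asymptotically_standardized
    {Ω : Type*} [m0 : MeasurableSpace Ω] {P : Measure Ω} [IsProbabilityMeasure P]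
    (F : MeasureTheory.Filtration ℕ m0)
    (z : ℕ → Ω → ℝ) (C : ℝ)
    (hint : ∀ t, 1 ≤ t → Integrable (z t) P)
    (hmeas : ∀ t, 1 ≤ t → Measurable[F t] (z t))
    (hbdd : ∀ t, 1 ≤ t → ∀ᵐ ω ∂P, |z t ω| ≤ C)
    (hmds : ∀ t, 1 ≤ t → P[z t | F (t - 1)] =ᵐ[P] fun _ => (0 : ℝ))
    (hvar : Tendsto
      (fun t : ℕ => ∫ ω, |(P[(fun ω' => (z t ω') ^ 2) | F (t - 1)]) ω - 1| ∂P) atTop (𝓝 0)) :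
    ∀ g : BoundedContinuousFunction ℝ ℝ,
      Tendsto (fun T : ℕ => ∫ ω, g ((Real.sqrt (T : ℝ))⁻¹ * ∑ t ∈ Finset.Icc 1 T, z t ω) ∂P)
        atTop (𝓝 (∫ x, g x ∂(gaussianReal 0 1))) := by
  have hSm : ∀ T : ℕ, AEMeasurable
      (fun ω => (Real.sqrt (T : ℝ))⁻¹ * ∑ t ∈ Finset.Icc 1 T, z t ω) P := fun T =>
    ((Finset.measurable_fun_sum _ fun t ht =>
      (hmeas t (Finset.mem_Icc.1 ht).1).mono (F.le t) le_rfl).const_mul _).aemeasurable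
  let μ : ℕ → ProbabilityMeasure ℝ := fun T =>
    ⟨P.map _, Measure.isProbabilityMeasure_map (hSm T)⟩
  let γ : ProbabilityMeasure ℝ := ⟨gaussianReal 0 1, inferInstance⟩
  have hlim : Tendsto μ atTop (𝓝 γ) := by
    refine ProbabilityMeasure.tendsto_of_tendsto_charFun fun u => ?_
    have hu := tendsto_charFun_normalized_sum_mds F z C hmeas hbdd hmds hvar u
    simp only [μ, γ, ProbabilityMeasure.coe_mk, charFun_gaussianReal]
    convert hu using 2 with T
    · rw [charFun_apply_real, integral_map (hSm T) (by fun_prop)]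
      congr 1 with ω
      push_cast
      ring_nf
    · congr 1
      simp
      ring
  intro g
  refine (ProbabilityMeasure.tendsto_iff_forall_integral_tendsto.1 hlim g).congr fun T => ?_
  exact integral_map (hSm T) g.continuous.aestronglyMeasurable
end
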